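/- arXiv:2303.00305 — 2 statements merged into one kernel-verified Lean document; each statement's English description precedes it below -/
import Mathlib

section
/- For every integer n ≥ 2, the graph Σ = Σ(H(n),X,Y) is semisymmetric: Σ is regular of valency 2^n, its full automorphism group Aut(Σ) acts transitively on the edge set of Σ, but Aut(Σ) does not act transitively on the vertex set of Σ. -/
/-- The commutator `[g,h] = g⁻¹h⁻¹gh` (paper convention). -/
def gcomm {G : Type*} [Group G] (g h : G) : G := g⁻¹ * h⁻¹ * g * h

/-- The generator index set for `H(n)`: `Sum.inl i` is `x_i`, `Sum.inr j` is `y_j`. -/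
abbrev HGen (n : ℕ) := Fin n ⊕ Fin n

/-- The word `x_i` in the free group. -/
def xw {n : ℕ} (i : Fin n) : FreeGroup (HGen n) := FreeGroup.of (Sum.inl i)

/-- The word `y_j` in the free group. -/
def yw {n : ℕ} (j : Fin n) : FreeGroup (HGen n) := FreeGroup.of (Sum.inr j)

/-- The word `z` in the free group, for a generator `z`. -/
def zw {n : ℕ} (z : HGen n) : FreeGroup (HGen n) := FreeGroup.of z

/-- The relators of the presentation of `H(n)`. -/
def HRels (n : ℕ) : Set (FreeGroup (HGen n)) :=
  {w | ∃ z, w = zw z ^ 2} ∪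
  {w | ∃ i j, w = gcomm (xw i) (xw j)} ∪
  {w | ∃ i j, w = gcomm (yw i) (yw j)} ∪
  {w | ∃ i j, w = gcomm (xw i) (yw j) ^ 2} ∪
  {w | ∃ i j k, w = gcomm (gcomm (yw j) (xw i)) (yw k)} ∪
  {w | ∃ i j z, w = gcomm (gcomm (xw i) (yw j)) (zw z) ^ 2} ∪
  {w | ∃ z₁ z₂ z₃ z₄, w = gcomm (gcomm (gcomm (zw z₁) (zw z₂)) (zw z₃)) (zw z₄)}

/-- The group `H(n)` defined by the presentation. -/
abbrev Hn (n : ℕ) := PresentedGroup (HRels n)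

/-- The image of the generator `x_i` in `H(n)`. -/
def xH {n : ℕ} (i : Fin n) : Hn n := PresentedGroup.of (Sum.inl i)

/-- The image of the generator `y_j` in `H(n)`. -/
def yH {n : ℕ} (j : Fin n) : Hn n := PresentedGroup.of (Sum.inr j)

/-- The subgroup `X = ⟨x_1, …, x_n⟩` of `H(n)`. -/
def XH (n : ℕ) : Subgroup (Hn n) := Subgroup.closure (Set.range (xH (n := n)))

/-- The subgroup `Y = ⟨y_1, …, y_n⟩` of `H(n)`. -/
def YH (n : ℕ) : Subgroup (Hn n) := Subgroup.closure (Set.range (yH (n := n)))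

/-- The right coset `S·h` as a set. -/
def rcoset {G : Type*} [Group G] (S : Subgroup G) (h : G) : Set G := {g | ∃ s ∈ S, g = s * h}

/-- The vertex set of `Σ(H(n),X,Y)`: all right cosets of `X` and of `Y` in `H(n)`. -/
def SigmaV (n : ℕ) : Type :=
  {S : Set (Hn n) // (∃ h, S = rcoset (XH n) h) ∨ (∃ h, S = rcoset (YH n) h)}

/-- The graph `Σ(H(n),X,Y)`: `Xh` is adjacent to `Yg` iff `Xh ∩ Yg ≠ ∅`. -/
def SigmaGraph (n : ℕ) : SimpleGraph (SigmaV n) where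
  Adj u v := u ≠ v ∧ (u.val ∩ v.val).Nonempty ∧
    (((∃ h, u.val = rcoset (XH n) h) ∧ ∃ g, v.val = rcoset (YH n) g) ∨
     ((∃ h, v.val = rcoset (XH n) h) ∧ ∃ g, u.val = rcoset (YH n) g))
  symm := by
    constructor
    rintro u v ⟨hne, hint, hor⟩
    exact ⟨hne.symm, by rwa [Set.inter_comm], hor.symm⟩
  loopless := by constructor; rintro u ⟨hne, -⟩; exact hne rfl


/-! ### A small permutation model -/

abbrev PV (n : ℕ) := Fin n → ZMod 2

abbrev Pt := (ZMod 2 × ZMod 2) × ZMod 2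

/-- translation of the base -/
def Tp (a : ZMod 2 × ZMod 2) : Equiv.Perm Pt where
  toFun p := (p.1 + a, p.2)
  invFun p := (p.1 - a, p.2)
  left_inv p := by simp
  right_inv p := by simp

/-- fibre shift by a polynomial -/
def Dp (c0 c1 c2 c3 : ZMod 2) : Equiv.Perm Pt where
  toFun p := (p.1, p.2 + (c0 + c1 * p.1.1 + c2 * p.1.2 + c3 * (p.1.1 * p.1.2)))
  invFun p := (p.1, p.2 - (c0 + c1 * p.1.1 + c2 * p.1.2 + c3 * (p.1.1 * p.1.2)))
  left_inv p := by simp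
  right_inv p := by simp

/-- fibre shift supported over the origin -/
def Ep (l : ZMod 2) : Equiv.Perm Pt := Dp l l l l

/-- images of generators -/
def Kp : (ZMod 2 × ZMod 2) ⊕ ZMod 2 → Equiv.Perm Pt
  | Sum.inl a => Tp a
  | Sum.inr l => Ep l

theorem Kp_sq : ∀ z, Kp z ^ 2 = 1 := by decide
theorem Tp_comm : ∀ a b, gcomm (Tp a) (Tp b) = 1 := by decide
theorem Ep_comm : ∀ a b, gcomm (Ep a) (Ep b) = 1 := by decide
theorem TE_comm : ∀ a b, gcomm (Tp a) (Ep b) ^ 2 = 1 := by decide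
theorem ETE_comm : ∀ a b c, gcomm (gcomm (Ep b) (Tp a)) (Ep c) = 1 := by decide
theorem TEz_comm : ∀ a b z, gcomm (gcomm (Tp a) (Ep b)) (Kp z) ^ 2 = 1 := by decide
theorem K_comm1 : ∀ z z', ∃ c0 c1 c2, gcomm (Kp z) (Kp z') = Dp c0 c1 c2 0 := by decide
theorem K_comm2 : ∀ c0 c1 c2 z, ∃ c, gcomm (Dp c0 c1 c2 0) (Kp z) = Dp c 0 0 0 := by
  decide
theorem K_comm3 : ∀ c z, gcomm (Dp c 0 0 0) (Kp z) = 1 := by decide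
theorem K_comm : ∀ z₁ z₂ z₃ z₄, gcomm (gcomm (gcomm (Kp z₁) (Kp z₂)) (Kp z₃)) (Kp z₄) = 1 := by
  intro z₁ z₂ z₃ z₄
  obtain ⟨c0, c1, c2, h⟩ := K_comm1 z₁ z₂
  obtain ⟨c, h'⟩ := K_comm2 c0 c1 c2 z₃
  rw [h, h', K_comm3]

theorem Tp_add : ∀ a b, Tp (a + b) = Tp a * Tp b := by decide
theorem Ep_add : ∀ a b, Ep (a + b) = Ep a * Ep b := by decide
theorem Tp_zero : Tp 0 = 1 := by decide
theorem Ep_zero : Ep 0 = 1 := by decide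
theorem Tp_neg : ∀ a, Tp (-a) = (Tp a)⁻¹ := by decide
theorem Ep_neg : ∀ a, Ep (-a) = (Ep a)⁻¹ := by decide
theorem Ep_apply : ∀ l (p : Pt), Ep l p = (p.1, p.2 + if p.1 = 0 then l else 0) := by
  decide

theorem map_gcomm' {G K : Type*} [Group G] [Group K] (f : G →* K) (a b : G) :
    f (gcomm a b) = gcomm (f a) (f b) := by simp [gcomm]

/-- lift data: any map of generators satisfying the relators. -/
theorem rels_hold {n : ℕ} {K : Type*} [Group K] (f : HGen n → K)
    (h1 : ∀ z, f z ^ 2 = 1)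
    (h2 : ∀ i j, gcomm (f (Sum.inl i)) (f (Sum.inl j)) = 1)
    (h3 : ∀ i j, gcomm (f (Sum.inr i)) (f (Sum.inr j)) = 1)
    (h4 : ∀ i j, gcomm (f (Sum.inl i)) (f (Sum.inr j)) ^ 2 = 1)
    (h5 : ∀ i j k, gcomm (gcomm (f (Sum.inr j)) (f (Sum.inl i))) (f (Sum.inr k)) = 1)
    (h6 : ∀ i j z, gcomm (gcomm (f (Sum.inl i)) (f (Sum.inr j))) (f z) ^ 2 = 1)
    (h7 : ∀ z₁ z₂ z₃ z₄, gcomm (gcomm (gcomm (f z₁) (f z₂)) (f z₃)) (f z₄) = 1) :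
    ∀ r ∈ HRels n, FreeGroup.lift f r = 1 := by
  intro r hr
  rcases hr with ((((((⟨z, rfl⟩ | ⟨i, j, rfl⟩) | ⟨i, j, rfl⟩) | ⟨i, j, rfl⟩) | ⟨i, j, k, rfl⟩) |
    ⟨i, j, z, rfl⟩) | ⟨z₁, z₂, z₃, z₄, rfl⟩) <;>
  simp only [map_gcomm', map_pow, xw, yw, zw, FreeGroup.lift_apply_of, h1, h2, h3, h4, h5, h6, h7]

/-- The abelian projections. -/
theorem exists_rho (n : ℕ) (g : HGen n → PV n) :
    ∃ ρ : Hn n →* Multiplicative (PV n), ∀ z, ρ (PresentedGroup.of z) =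
      Multiplicative.ofAdd (g z) := by
  have key : ∀ a b : Multiplicative (PV n), gcomm a b = 1 := by
    intro a b
    rw [gcomm, mul_comm a⁻¹, mul_assoc b⁻¹, inv_mul_cancel, mul_one, inv_mul_cancel]
  refine ⟨PresentedGroup.toGroup (f := fun z => Multiplicative.ofAdd (g z))
    (rels_hold _ ?_ ?_ ?_ ?_ ?_ ?_ ?_), fun z => PresentedGroup.toGroup.of _⟩ <;> intros <;>
    try simp only [key, one_pow]
  rw [← ofAdd_nsmul]
  have : ∀ v : PV n, 2 • v = 0 := fun v => by
    rw [two_nsmul]; ext i; exact CharTwo.add_self_eq_zero _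
  rw [this]; rfl

noncomputable def rhoX (n : ℕ) : Hn n →* Multiplicative (PV n) :=
  (exists_rho n (fun z => Sum.elim (fun i => Pi.single i 1) (fun _ => 0) z)).choose

noncomputable def rhoY (n : ℕ) : Hn n →* Multiplicative (PV n) :=
  (exists_rho n (fun z => Sum.elim (fun _ => 0) (fun i => Pi.single i 1) z)).choose

theorem rhoX_x {n : ℕ} (i : Fin n) : rhoX n (xH i) = Multiplicative.ofAdd (Pi.single i 1) :=
  (exists_rho n (fun z => Sum.elim (fun i => Pi.single i 1) (fun _ => 0) z)).choose_spec _
theorem rhoX_y {n : ℕ} (i : Fin n) : rhoX n (yH i) = 1 :=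
  (exists_rho n (fun z => Sum.elim (fun i => Pi.single i 1) (fun _ => 0) z)).choose_spec _
theorem rhoY_x {n : ℕ} (i : Fin n) : rhoY n (xH i) = 1 :=
  (exists_rho n (fun z => Sum.elim (fun _ => 0) (fun i => Pi.single i 1) z)).choose_spec _
theorem rhoY_y {n : ℕ} (i : Fin n) : rhoY n (yH i) = Multiplicative.ofAdd (Pi.single i 1) :=
  (exists_rho n (fun z => Sum.elim (fun _ => 0) (fun i => Pi.single i 1) z)).choose_spec _

/-- Additive coordinates. -/
noncomputable def cX {n : ℕ} (h : Hn n) : PV n := (rhoX n h).toAdd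
noncomputable def cY {n : ℕ} (h : Hn n) : PV n := (rhoY n h).toAdd

theorem cX_mul {n : ℕ} (g h : Hn n) : cX (g * h) = cX g + cX h := by simp [cX]
theorem cY_mul {n : ℕ} (g h : Hn n) : cY (g * h) = cY g + cY h := by simp [cY]
theorem cX_one {n : ℕ} : cX (1 : Hn n) = 0 := by simp [cX]
theorem cY_one {n : ℕ} : cY (1 : Hn n) = 0 := by simp [cY]
theorem cX_inv {n : ℕ} (g : Hn n) : cX g⁻¹ = - cX g := by simp [cX]
theorem cY_inv {n : ℕ} (g : Hn n) : cY g⁻¹ = - cY g := by simp [cY]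
theorem cX_x {n : ℕ} (i : Fin n) : cX (xH i) = Pi.single i 1 := by simp [cX, rhoX_x]
theorem cY_y {n : ℕ} (i : Fin n) : cY (yH i) = Pi.single i 1 := by simp [cY, rhoY_y]

theorem cX_of_mem_Y {n : ℕ} {y : Hn n} (hy : y ∈ YH n) : cX y = 0 := by
  induction hy using Subgroup.closure_induction with
  | mem x hx => obtain ⟨i, rfl⟩ := hx; simp [cX, rhoX_y]
  | one => exact cX_one
  | mul a b _ _ ha hb => rw [cX_mul, ha, hb, add_zero]
  | inv a _ ha => rw [cX_inv, ha, neg_zero]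

theorem cY_of_mem_X {n : ℕ} {y : Hn n} (hy : y ∈ XH n) : cY y = 0 := by
  induction hy using Subgroup.closure_induction with
  | mem x hx => obtain ⟨i, rfl⟩ := hx; simp [cY, rhoY_x]
  | one => exact cY_one
  | mul a b _ _ ha hb => rw [cY_mul, ha, hb, add_zero]
  | inv a _ ha => rw [cY_inv, ha, neg_zero]

/-- relators vanish in the quotient -/
theorem rel_eq_one {n : ℕ} {w : FreeGroup (HGen n)} (h : w ∈ HRels n) :
    PresentedGroup.mk (HRels n) w = 1 := PresentedGroup.one_of_mem h

theorem z_sq {n : ℕ} (z : HGen n) : (PresentedGroup.of z : Hn n) ^ 2 = 1 := by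
  have h : zw z ^ 2 ∈ HRels n := by
    simp only [HRels, Set.mem_union, Set.mem_ofPred_eq]
    exact Or.inl (Or.inl (Or.inl (Or.inl (Or.inl (Or.inl ⟨z, rfl⟩)))))
  have := rel_eq_one h
  rw [map_pow] at this
  exact this

theorem gcomm_eq_one {G : Type*} [Group G] {a b : G} (h : gcomm a b = 1) : Commute a b := by
  have h' : (b * a)⁻¹ * (a * b) = 1 := by rw [← h, gcomm]; group
  exact (inv_mul_eq_one.mp h').symm

theorem x_comm {n : ℕ} (i j : Fin n) : Commute (xH i : Hn n) (xH j) := by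
  have h : gcomm (xw i) (xw j) ∈ HRels n := by
    simp only [HRels, Set.mem_union, Set.mem_ofPred_eq]
    exact Or.inl (Or.inl (Or.inl (Or.inl (Or.inl (Or.inr ⟨i, j, rfl⟩)))))
  have := rel_eq_one h
  rw [map_gcomm'] at this
  exact gcomm_eq_one this

theorem y_comm {n : ℕ} (i j : Fin n) : Commute (yH i : Hn n) (yH j) := by
  have h : gcomm (yw i) (yw j) ∈ HRels n := by
    simp only [HRels, Set.mem_union, Set.mem_ofPred_eq]
    exact Or.inl (Or.inl (Or.inl (Or.inl (Or.inr ⟨i, j, rfl⟩))))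
  have := rel_eq_one h
  rw [map_gcomm'] at this
  exact gcomm_eq_one this

theorem c_comm {n : ℕ} (i j k : Fin n) : Commute (gcomm (yH j : Hn n) (xH i)) (yH k) := by
  have h : gcomm (gcomm (yw j) (xw i)) (yw k) ∈ HRels n := by
    simp only [HRels, Set.mem_union, Set.mem_ofPred_eq]
    exact Or.inl (Or.inl (Or.inr ⟨i, j, k, rfl⟩))
  have := rel_eq_one h
  rw [map_gcomm', map_gcomm'] at this
  exact gcomm_eq_one this

theorem x_mul_self {n : ℕ} (i : Fin n) : (xH i : Hn n) * xH i = 1 := by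
  rw [← sq]; exact z_sq _
theorem y_mul_self {n : ℕ} (i : Fin n) : (yH i : Hn n) * yH i = 1 := by
  rw [← sq]; exact z_sq _

/-- Elementary abelian subgroups: a section. -/
theorem section_exists {n : ℕ} {G : Type*} [Group G] (g : Fin n → G)
    (h2 : ∀ i, g i * g i = 1) (hc : ∀ i j, Commute (g i) (g j)) :
    ∃ s : Multiplicative (PV n) →* G,
      (∀ i, s (Multiplicative.ofAdd (Pi.single i 1)) = g i) := by
  let f : ∀ _ : Fin n, ZMod 2 →+ Additive G := fun i =>
    ZMod.lift 2 ⟨zmultiplesHom (Additive G) (Additive.ofMul (g i)), by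
      simp only [zmultiplesHom_apply]
      change (((2 : ℕ) : ℤ) • Additive.ofMul (g i)) = 0
      rw [natCast_zsmul, two_nsmul]
      exact h2 i⟩
  have hf : ∀ i (a : ZMod 2), ∃ k : ℤ, f i a = Additive.ofMul (g i ^ k) := by
    intro i a
    obtain ⟨k, rfl⟩ := ZMod.intCast_surjective a
    exact ⟨k, by simp [f]⟩
  have hcomm : Pairwise fun i j => ∀ x y, AddCommute (f i x) (f j y) := by
    intro i j _ x y
    obtain ⟨k, hk⟩ := hf i x
    obtain ⟨l, hl⟩ := hf j y
    rw [hk, hl]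
    exact congrArg Additive.ofMul ((hc i j).zpow_zpow k l).eq
  refine ⟨AddMonoidHom.toMultiplicativeLeft (AddMonoidHom.noncommPiCoprod f hcomm), fun i => ?_⟩
  have := AddMonoidHom.noncommPiCoprod_single f (hcomm := hcomm) i 1
  have h1 : f i 1 = Additive.ofMul (g i) := by
    have : (1 : ZMod 2) = ((1 : ℤ) : ZMod 2) := by simp
    rw [this]; simp only [f]; rw [ZMod.lift_coe]; simp
  rw [h1] at this
  exact congrArg Additive.toMul this

theorem closure_structure {n : ℕ} {G : Type*} [Group G] (g : Fin n → G)
    (h2 : ∀ i, g i * g i = 1) (hc : ∀ i j, Commute (g i) (g j))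
    (ρ : G →* Multiplicative (PV n)) (hρ : ∀ i, ρ (g i) = Multiplicative.ofAdd (Pi.single i 1)) :
    (∀ x ∈ Subgroup.closure (Set.range g), ρ x = 1 → x = 1) ∧
    Nat.card (Subgroup.closure (Set.range g)) = 2 ^ n := by
  obtain ⟨s, hs⟩ := section_exists g h2 hc
  have hsρ : ∀ x ∈ Subgroup.closure (Set.range g), s (ρ x) = x := by
    intro x hx
    induction hx using Subgroup.closure_induction with
    | mem x hx => obtain ⟨i, rfl⟩ := hx; rw [hρ, hs]
    | one => simp
    | mul a b _ _ ha hb => rw [map_mul, map_mul, ha, hb]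
    | inv a _ ha => rw [map_inv, map_inv, ha]
  have hinj : ∀ x ∈ Subgroup.closure (Set.range g), ρ x = 1 → x = 1 := by
    intro x hx h
    rw [← hsρ x hx, h, map_one]
  refine ⟨hinj, ?_⟩
  have hmem : ∀ v : PV n, ∃ x ∈ Subgroup.closure (Set.range g), ρ x = Multiplicative.ofAdd v := by
    intro v
    induction v using Pi.single_induction with
    | zero => exact ⟨1, one_mem _, by simp⟩
    | add a b ha hb =>
      obtain ⟨x, hx, hx'⟩ := ha
      obtain ⟨y, hy, hy'⟩ := hb
      exact ⟨x * y, mul_mem hx hy, by rw [map_mul, hx', hy']; rfl⟩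
    | single i a =>
      have : a = 0 ∨ a = 1 := by revert a; decide
      rcases this with rfl | rfl
      · exact ⟨1, one_mem _, by simp⟩
      · exact ⟨g i, Subgroup.subset_closure ⟨i, rfl⟩, hρ i⟩
  have hbij : Function.Bijective
      (fun x : Subgroup.closure (Set.range g) => (ρ x.1).toAdd) := by
    constructor
    · intro a b hab
      have : ρ a.1 = ρ b.1 := hab
      have h3 := hinj (a.1 * b.1⁻¹) (mul_mem a.2 (inv_mem b.2)) (by
        rw [map_mul, map_inv, this, mul_inv_cancel])
      exact Subtype.ext (mul_inv_eq_one.mp h3)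
    · intro v
      obtain ⟨x, hx, hx'⟩ := hmem v
      exact ⟨⟨x, hx⟩, by simp [hx']⟩
  rw [Nat.card_eq_of_bijective _ hbij]
  simp

theorem X_struct (n : ℕ) : (∀ x ∈ XH n, cX x = 0 → x = 1) ∧ Nat.card (XH n) = 2 ^ n := 
  closure_structure xH x_mul_self x_comm (rhoX n) rhoX_x

theorem Y_struct (n : ℕ) : (∀ x ∈ YH n, cY x = 0 → x = 1) ∧ Nat.card (YH n) = 2 ^ n := 
  closure_structure yH y_mul_self y_comm (rhoY n) rhoY_y

theorem inter_trivial {n : ℕ} {h : Hn n} (hx : h ∈ XH n) (hy : h ∈ YH n) : h = 1 :=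
  (X_struct n).1 h hx (cX_of_mem_Y hy)

theorem xH_mem {n : ℕ} (i : Fin n) : xH i ∈ XH n := Subgroup.subset_closure ⟨i, rfl⟩
theorem yH_mem {n : ℕ} (i : Fin n) : yH i ∈ YH n := Subgroup.subset_closure ⟨i, rfl⟩

/-! ### The separating functions -/

theorem exists_F {n : ℕ} (π : PV n →+ ZMod 2 × ZMod 2) (l : PV n →+ ZMod 2)
    (P : ZMod 2 × ZMod 2) :
    ∃ F : Hn n → ZMod 2, ∀ x₀ ∈ XH n, ∀ y' ∈ YH n, ∀ x' ∈ XH n, ∀ y ∈ YH n, ∀ x ∈ XH n,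
      F (x₀ * (y' * x' * y * x)) = (if P + π (cX x) = 0 then l (cY y) else 0) +
        (if P + π (cX x) + π (cX x') = 0 then l (cY y') else 0) := by
  let k : HGen n → (ZMod 2 × ZMod 2) ⊕ ZMod 2 :=
    Sum.map (fun i => π (Pi.single i 1)) (fun i => l (Pi.single i 1))
  let Φ : Hn n →* Equiv.Perm Pt := PresentedGroup.toGroup (f := fun z => Kp (k z))
    (rels_hold _ (fun z => Kp_sq _) (fun i j => Tp_comm _ _) (fun i j => Ep_comm _ _)
      (fun i j => TE_comm _ _) (fun i j m => ETE_comm _ _ _) (fun i j z => TEz_comm _ _ _)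
      (fun _ _ _ _ => K_comm _ _ _ _))
  have hof : ∀ z, Φ (PresentedGroup.of z) = Kp (k z) := fun z => PresentedGroup.toGroup.of _
  have hX : ∀ x ∈ XH n, Φ x = Tp (π (cX x)) := by
    intro x hx
    induction hx using Subgroup.closure_induction with
    | mem x hx => obtain ⟨i, rfl⟩ := hx; rw [cX_x]; exact hof _
    | one => rw [cX_one, map_one, map_zero, Tp_zero]
    | mul a b _ _ ha hb => rw [cX_mul, map_mul, ha, hb, map_add, Tp_add]
    | inv a _ ha => rw [cX_inv, map_inv, ha, map_neg, Tp_neg]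
  have hY : ∀ x ∈ YH n, Φ x = Ep (l (cY x)) := by
    intro x hx
    induction hx using Subgroup.closure_induction with
    | mem x hx => obtain ⟨i, rfl⟩ := hx; rw [cY_y]; exact hof _
    | one => rw [cY_one, map_one, map_zero, Ep_zero]
    | mul a b _ _ ha hb => rw [cY_mul, map_mul, ha, hb, map_add, Ep_add]
    | inv a _ ha => rw [cY_inv, map_inv, ha, map_neg, Ep_neg]
  refine ⟨fun h => (Φ h (P, 0)).2, fun x₀ h0 y' hy' x' hx' y hy x hx => ?_⟩
  simp only [map_mul, Equiv.Perm.mul_apply, hX _ h0, hX _ hx', hX _ hx, hY _ hy, hY _ hy',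
    Ep_apply]
  simp [Tp]
  congr

/-! ### Vertices and adjacency -/

def vX {n : ℕ} (h : Hn n) : SigmaV n := ⟨rcoset (XH n) h, Or.inl ⟨h, rfl⟩⟩
def vY {n : ℕ} (h : Hn n) : SigmaV n := ⟨rcoset (YH n) h, Or.inr ⟨h, rfl⟩⟩

theorem rcoset_eq {G : Type*} [Group G] {S : Subgroup G} {g h : G} :
    rcoset S g = rcoset S h ↔ g * h⁻¹ ∈ S := by
  constructor
  · intro e
    have : g ∈ rcoset S h := by rw [← e]; exact ⟨1, one_mem _, by simp⟩
    obtain ⟨s, hs, rfl⟩ := this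
    simpa using hs
  · intro hm
    ext k
    constructor
    · rintro ⟨s, hs, rfl⟩
      exact ⟨s * (g * h⁻¹), mul_mem hs hm, by group⟩
    · rintro ⟨s, hs, rfl⟩
      exact ⟨s * (g * h⁻¹)⁻¹, mul_mem hs (inv_mem hm), by group⟩

theorem vX_eq {n : ℕ} {g h : Hn n} : vX g = vX h ↔ g * h⁻¹ ∈ XH n :=
  Subtype.ext_iff.trans rcoset_eq
theorem vY_eq {n : ℕ} {g h : Hn n} : vY g = vY h ↔ g * h⁻¹ ∈ YH n :=
  Subtype.ext_iff.trans rcoset_eq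

theorem rcoset_ne {n : ℕ} (hn : 2 ≤ n) {g h : Hn n} :
    rcoset (XH n) g ≠ rcoset (YH n) h := by
  intro e
  have hg : g ∈ rcoset (YH n) h := by rw [← e]; exact ⟨1, one_mem _, by simp⟩
  let i : Fin n := ⟨0, by omega⟩
  have hg' : xH i * g ∈ rcoset (YH n) h := by rw [← e]; exact ⟨xH i, xH_mem i, rfl⟩
  obtain ⟨s, hs, e1⟩ := hg
  obtain ⟨t, ht, e2⟩ := hg'
  have hx : xH i ∈ YH n := by
    have : (xH i : Hn n) = t * s⁻¹ := by
      rw [e1] at e2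
      rw [eq_mul_inv_iff_mul_eq]
      exact mul_right_cancel (by rw [mul_assoc]; exact e2)
    rw [this]; exact mul_mem ht (inv_mem hs)
  have h0 := cX_of_mem_Y hx
  rw [cX_x] at h0
  have := congrFun h0 i
  simp at this

theorem adj_vX {n : ℕ} (hn : 2 ≤ n) {h : Hn n} {v : SigmaV n} :
    (SigmaGraph n).Adj (vX h) v ↔ ∃ x ∈ XH n, v = vY (x * h) := by
  constructor
  · rintro ⟨-, ⟨k, ⟨x, hx, hk⟩, hk2⟩, (⟨-, g, hg⟩ | ⟨-, g, hg⟩)⟩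
    · refine ⟨x, hx, Subtype.ext ?_⟩
      rw [hg] at hk2 ⊢
      obtain ⟨y, hy, hk3⟩ := hk2
      change _ = rcoset (YH n) (x * h)
      rw [← hk, hk3, rcoset_eq]
      simpa using hy
    · exact absurd hg (rcoset_ne hn)
  · rintro ⟨x, hx, rfl⟩
    refine ⟨fun e => rcoset_ne hn (congrArg Subtype.val e),
      ⟨x * h, ⟨x, hx, rfl⟩, ⟨1, one_mem _, by simp⟩⟩, Or.inl ⟨⟨h, rfl⟩, ⟨x * h, rfl⟩⟩⟩

theorem adj_vY {n : ℕ} (hn : 2 ≤ n) {h : Hn n} {v : SigmaV n} :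
    (SigmaGraph n).Adj (vY h) v ↔ ∃ y ∈ YH n, v = vX (y * h) := by
  constructor
  · rintro ⟨-, ⟨k, ⟨x, hx, hk⟩, hk2⟩, (⟨⟨g, hg⟩, -⟩ | ⟨⟨g, hg⟩, -⟩)⟩
    · exact absurd hg.symm (rcoset_ne hn)
    · refine ⟨x, hx, Subtype.ext ?_⟩
      rw [hg] at hk2 ⊢
      obtain ⟨y, hy, hk3⟩ := hk2
      change _ = rcoset (XH n) (x * h)
      rw [← hk, hk3, rcoset_eq]
      simpa using hy
  · rintro ⟨x, hx, rfl⟩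
    refine ⟨fun e => rcoset_ne hn (congrArg Subtype.val e).symm,
      ⟨x * h, ⟨x, hx, rfl⟩, ⟨1, one_mem _, by simp⟩⟩, Or.inr ⟨⟨x * h, rfl⟩, ⟨h, rfl⟩⟩⟩

theorem vertex_cases {n : ℕ} (v : SigmaV n) : (∃ h, v = vX h) ∨ (∃ h, v = vY h) := by
  obtain ⟨S, (⟨h, rfl⟩ | ⟨h, rfl⟩)⟩ := v
  · exact Or.inl ⟨h, rfl⟩
  · exact Or.inr ⟨h, rfl⟩

theorem valency {n : ℕ} (hn : 2 ≤ n) (v : SigmaV n) :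
    Nat.card ((SigmaGraph n).neighborSet v) = 2 ^ n := by
  rcases vertex_cases v with ⟨h, rfl⟩ | ⟨h, rfl⟩
  · rw [← (X_struct n).2]
    symm
    refine Nat.card_eq_of_bijective
      (fun x : XH n => (⟨vY (x.1 * h), (adj_vX hn).2 ⟨x.1, x.2, rfl⟩⟩ :
        (SigmaGraph n).neighborSet (vX h))) ⟨?_, ?_⟩
    · intro a b hab
      have h1 := vY_eq.1 (congrArg Subtype.val hab)
      have h2 : a.1 * b.1⁻¹ ∈ YH n := by
        convert h1 using 1; group
      exact Subtype.ext (mul_inv_eq_one.mp (inter_trivial (mul_mem a.2 (inv_mem b.2)) h2))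
    · rintro ⟨w, hw⟩
      obtain ⟨x, hx, rfl⟩ := (adj_vX hn).1 hw
      exact ⟨⟨x, hx⟩, rfl⟩
  · rw [← (Y_struct n).2]
    symm
    refine Nat.card_eq_of_bijective
      (fun x : YH n => (⟨vX (x.1 * h), (adj_vY hn).2 ⟨x.1, x.2, rfl⟩⟩ :
        (SigmaGraph n).neighborSet (vY h))) ⟨?_, ?_⟩
    · intro a b hab
      have h1 := vX_eq.1 (congrArg Subtype.val hab)
      have h2 : a.1 * b.1⁻¹ ∈ XH n := by
        convert h1 using 1; group
      exact Subtype.ext (mul_inv_eq_one.mp (inter_trivial h2 (mul_mem a.2 (inv_mem b.2))))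
    · rintro ⟨w, hw⟩
      obtain ⟨x, hx, rfl⟩ := (adj_vY hn).1 hw
      exact ⟨⟨x, hx⟩, rfl⟩

/-! ### Edge transitivity -/

theorem rcoset_translate {G : Type*} [Group G] (S : Subgroup G) (h k : G) :
    (fun g => g * k⁻¹) ⁻¹' (rcoset S h) = rcoset S (h * k) := by
  ext g
  constructor
  · rintro ⟨s, hs, e⟩
    exact ⟨s, hs, by rw [← mul_assoc, ← e]; group⟩
  · rintro ⟨s, hs, rfl⟩
    exact ⟨s, hs, by group⟩

def transV {n : ℕ} (k : Hn n) (v : SigmaV n) : SigmaV n :=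
  ⟨(fun g => g * k⁻¹) ⁻¹' v.1, by
    rcases v.2 with ⟨h, e⟩ | ⟨h, e⟩
    · exact Or.inl ⟨h * k, by rw [e, rcoset_translate]⟩
    · exact Or.inr ⟨h * k, by rw [e, rcoset_translate]⟩⟩

theorem transV_vX {n : ℕ} (k h : Hn n) : transV k (vX h) = vX (h * k) :=
  Subtype.ext (rcoset_translate _ _ _)
theorem transV_vY {n : ℕ} (k h : Hn n) : transV k (vY h) = vY (h * k) :=
  Subtype.ext (rcoset_translate _ _ _)

theorem transV_inv {n : ℕ} (k k' : Hn n) (hk : k * k' = 1) (v : SigmaV n) :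
    transV k' (transV k v) = v := by
  rcases vertex_cases v with ⟨h, rfl⟩ | ⟨h, rfl⟩
  · rw [transV_vX, transV_vX, mul_assoc, hk, mul_one]
  · rw [transV_vY, transV_vY, mul_assoc, hk, mul_one]

theorem transV_adj {n : ℕ} (hn : 2 ≤ n) (k : Hn n) {u v : SigmaV n}
    (h : (SigmaGraph n).Adj u v) : (SigmaGraph n).Adj (transV k u) (transV k v) := by
  rcases vertex_cases u with ⟨g, rfl⟩ | ⟨g, rfl⟩
  · obtain ⟨x, hx, rfl⟩ := (adj_vX hn).1 h
    rw [transV_vX, transV_vY, adj_vX hn]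
    exact ⟨x, hx, by rw [mul_assoc]⟩
  · obtain ⟨x, hx, rfl⟩ := (adj_vY hn).1 h
    rw [transV_vX, transV_vY, adj_vY hn]
    exact ⟨x, hx, by rw [mul_assoc]⟩

def transIso {n : ℕ} (hn : 2 ≤ n) (k : Hn n) : SigmaGraph n ≃g SigmaGraph n where
  toFun := transV k
  invFun := transV k⁻¹
  left_inv := transV_inv _ _ (mul_inv_cancel k)
  right_inv := transV_inv _ _ (inv_mul_cancel k)
  map_rel_iff' := by
    intro a b
    refine ⟨fun h => ?_, fun h => transV_adj hn k h⟩
    have := transV_adj hn k⁻¹ h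
    simpa only [Equiv.coe_fn_mk, transV_inv _ _ (mul_inv_cancel k)] using this

theorem edge_form {n : ℕ} (hn : 2 ≤ n) {u v : SigmaV n} (h : (SigmaGraph n).Adj u v) :
    ∃ g, (u = vX g ∧ v = vY g) ∨ (u = vY g ∧ v = vX g) := by
  rcases vertex_cases u with ⟨g, rfl⟩ | ⟨g, rfl⟩
  · obtain ⟨x, hx, rfl⟩ := (adj_vX hn).1 h
    exact ⟨x * g, Or.inl ⟨vX_eq.2 (by simpa using hx), rfl⟩⟩
  · obtain ⟨x, hx, rfl⟩ := (adj_vY hn).1 h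
    exact ⟨x * g, Or.inr ⟨vY_eq.2 (by simpa using hx), rfl⟩⟩

theorem edge_trans {n : ℕ} (hn : 2 ≤ n) (u v a b : SigmaV n) (h : (SigmaGraph n).Adj u v)
    (h' : (SigmaGraph n).Adj a b) :
    ∃ φ : SigmaGraph n ≃g SigmaGraph n, (φ u = a ∧ φ v = b) ∨ (φ u = b ∧ φ v = a) := by
  obtain ⟨g, hg⟩ := edge_form hn h
  obtain ⟨k, hk⟩ := edge_form hn h'
  have h1 : transIso hn (g⁻¹ * k) (vX g) = vX k := by
    change transV _ _ = _
    rw [transV_vX]; simp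
  have h2 : transIso hn (g⁻¹ * k) (vY g) = vY k := by
    change transV _ _ = _
    rw [transV_vY]; simp
  refine ⟨transIso hn (g⁻¹ * k), ?_⟩
  rcases hg with ⟨rfl, rfl⟩ | ⟨rfl, rfl⟩ <;> rcases hk with ⟨rfl, rfl⟩ | ⟨rfl, rfl⟩ <;>
    simp [h1, h2]

/-! ### The distinguishing property -/

def FarPar {V : Type*} (G : SimpleGraph V) (u : V) : Prop :=
  ∃ w, (¬ ∃ p, G.Adj u p ∧ G.Adj p w) ∧
    ∀ p, G.Adj u p → ∃ l q, G.Adj p l ∧ G.Adj l q ∧ G.Adj q w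

theorem farPar_iso {V : Type*} {G : SimpleGraph V} (φ : G ≃g G) {u : V} (h : FarPar G u) :
    FarPar G (φ u) := by
  obtain ⟨w, h1, h2⟩ := h
  refine ⟨φ w, ?_, ?_⟩
  · rintro ⟨p, hp1, hp2⟩
    obtain ⟨p, rfl⟩ := φ.surjective p
    exact h1 ⟨p, φ.map_adj_iff.1 hp1, φ.map_adj_iff.1 hp2⟩
  · intro p hp
    obtain ⟨p, rfl⟩ := φ.surjective p
    obtain ⟨l, q, a, b, c⟩ := h2 p (φ.map_adj_iff.1 hp)
    exact ⟨φ l, φ q, φ.map_adj_iff.2 a, φ.map_adj_iff.2 b, φ.map_adj_iff.2 c⟩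

theorem dist_Y {n : ℕ} (hn : 2 ≤ n) : FarPar (SigmaGraph n) (vY 1) := by
  let i : Fin n := ⟨0, by omega⟩
  have hxi : (xH i : Hn n)⁻¹ = xH i := inv_eq_of_mul_eq_one_right (x_mul_self i)
  have hyi : (yH i : Hn n)⁻¹ = yH i := inv_eq_of_mul_eq_one_right (y_mul_self i)
  have hc : ∀ y ∈ YH n, Commute (xH i * yH i * xH i) y := by
    intro y hy
    induction hy using Subgroup.closure_induction with
    | mem x hx =>
      obtain ⟨k, rfl⟩ := hx
      have h1 := (y_comm i k).mul_left (c_comm i i k)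
      have h2 : (xH i : Hn n) * yH i * xH i = yH i * gcomm (yH i) (xH i) := by
        rw [gcomm, hxi, ← mul_assoc, ← mul_assoc, ← mul_assoc, mul_inv_cancel, one_mul]
      rw [h2]; exact h1
    | one => exact Commute.one_right _
    | mul a b _ _ ha hb => exact ha.mul_right hb
    | inv a _ ha => exact ha.inv_right
  refine ⟨vY (xH i * yH i * xH i), ?_, ?_⟩
  · rintro ⟨p, hp1, hp2⟩
    obtain ⟨y, hy, rfl⟩ := (adj_vY hn).1 hp1
    obtain ⟨x, hx, e⟩ := (adj_vX hn).1 hp2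
    have e := vY_eq.1 e
    have hxc : cX x = 0 := by
      have := cX_of_mem_Y e
      simp only [cX_mul, cX_inv, cX_x, cX_one, cX_of_mem_Y hy, cX_of_mem_Y (yH_mem i)] at this
      have h2 : (Pi.single i 1 : PV n) + Pi.single i 1 = 0 := by
        ext j; exact CharTwo.add_self_eq_zero _
      simpa [h2] using this
    have hx1 := (X_struct n).1 x hx hxc
    subst hx1
    have hmem : xH i * yH i * xH i ∈ YH n := by
      have := mul_mem e hy
      simpa using this
    obtain ⟨F, hF⟩ := exists_F (n := n)
      ((AddMonoidHom.inl (ZMod 2) (ZMod 2)).comp (Pi.evalAddMonoidHom (fun _ => ZMod 2) i))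
      (Pi.evalAddMonoidHom (fun _ => ZMod 2) i) (1, 0)
    have f1 := hF 1 (one_mem _) 1 (one_mem _) (xH i) (xH_mem i) (yH i) (yH_mem i) (xH i) (xH_mem i)
    have f2 := hF 1 (one_mem _) 1 (one_mem _) 1 (one_mem _) _ hmem 1 (one_mem _)
    simp only [one_mul, mul_one] at f1 f2
    rw [f2] at f1
    simp only [cX_one, cY_one, cX_x, cY_y] at f1
    simp at f1
    revert f1
    decide
  · intro p hp
    obtain ⟨y, hy, rfl⟩ := (adj_vY hn).1 hp
    refine ⟨vY (xH i * y), vX (yH i * xH i * y), ?_, ?_, ?_⟩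
    · rw [adj_vX hn]; exact ⟨xH i, xH_mem i, by rw [mul_one]⟩
    · rw [adj_vY hn]; exact ⟨yH i, yH_mem i, by rw [mul_assoc]⟩
    · rw [adj_vX hn]
      refine ⟨xH i, xH_mem i, ?_⟩
      rw [vY_eq, ← mul_assoc, ← mul_assoc, (hc y hy).eq, mul_inv_rev, ← mul_assoc,
        mul_inv_cancel, one_mul]
      exact inv_mem hy

theorem sep_one {n : ℕ} {p : PV n} (hp : p ≠ 0) : ∃ l : PV n →+ ZMod 2, l p ≠ 0 := by
  obtain ⟨i, hi⟩ := Function.ne_iff.1 hp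
  exact ⟨Pi.evalAddMonoidHom (fun _ => ZMod 2) i, hi⟩

theorem sep_two {n : ℕ} {p q : PV n} (hp : p ≠ 0) (hq : q ≠ 0) :
    ∃ l : PV n →+ ZMod 2, l p ≠ 0 ∧ l q ≠ 0 := by
  obtain ⟨a, ha⟩ := sep_one hp
  obtain ⟨b, hb⟩ := sep_one hq
  by_cases h1 : a q = 0
  · by_cases h2 : b p = 0
    · exact ⟨a + b, by simpa [h2] using ha, by simpa [h1] using hb⟩
    · exact ⟨b, h2, hb⟩
  · exact ⟨a, ha, h1⟩

theorem sep_three {n : ℕ} {p q r : PV n} (hp : p ≠ 0) (hq : q ≠ 0) (hr : r ≠ 0) :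
    ∃ π : PV n →+ ZMod 2 × ZMod 2, π p ≠ 0 ∧ π q ≠ 0 ∧ π r ≠ 0 := by
  obtain ⟨a, ha, ha'⟩ := sep_two hp hq
  obtain ⟨b, hb⟩ := sep_one hr
  exact ⟨a.prod b, fun h => ha (congrArg Prod.fst h), fun h => ha' (congrArg Prod.fst h),
    fun h => hb (congrArg Prod.snd h)⟩

theorem PV_add_self {n : ℕ} (v : PV n) : v + v = 0 := by
  ext j; exact CharTwo.add_self_eq_zero _

theorem PV_add_eq {n : ℕ} {v w : PV n} : v + w = 0 ↔ v = w := by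
  constructor
  · intro h
    have : v + w + w = w := by rw [h, zero_add]
    rwa [add_assoc, PV_add_self, add_zero] at this
  · rintro rfl; exact PV_add_self _

theorem not_dist_X {n : ℕ} (hn : 2 ≤ n) : ¬ FarPar (SigmaGraph n) (vX 1) := by
  rintro ⟨w, h1, h2⟩
  have key : ∀ x ∈ XH n, ∃ y ∈ YH n, ∃ x' ∈ XH n, ∃ y' ∈ YH n, w = vX (y' * x' * y * x) := by
    intro x hx
    obtain ⟨l, q, a, b, c⟩ := h2 (vY x) ((adj_vX hn).2 ⟨x, hx, by rw [mul_one]⟩)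
    obtain ⟨y, hy, rfl⟩ := (adj_vY hn).1 a
    obtain ⟨x', hx', rfl⟩ := (adj_vX hn).1 b
    obtain ⟨y', hy', rfl⟩ := (adj_vY hn).1 c
    exact ⟨y, hy, x', hx', y', hy', by simp only [mul_assoc]⟩
  have nokey : ∀ x ∈ XH n, ∀ y ∈ YH n, w ≠ vX (y * x) := by
    intro x hx y hy e
    exact h1 ⟨vY x, (adj_vX hn).2 ⟨x, hx, by rw [mul_one]⟩, (adj_vY hn).2 ⟨y, hy, e⟩⟩
  obtain ⟨b, hb, x₁, hx₁, a, ha, e₁⟩ := key 1 (one_mem _)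
  have hx₁0 : cX x₁ ≠ 0 := by
    intro h
    have := (X_struct n).1 x₁ hx₁ h
    subst this
    exact nokey 1 (one_mem _) (a * b) (mul_mem ha hb) (by simpa using e₁)
  have ha0 : cY a ≠ 0 := by
    intro h
    have := (Y_struct n).1 a ha h
    subst this
    refine nokey 1 (one_mem _) b hb ?_
    rw [e₁, vX_eq]
    simpa using hx₁
  have hb0 : cY b ≠ 0 := by
    intro h
    have := (Y_struct n).1 b hb h
    subst this
    exact nokey x₁ hx₁ a ha (by simpa using e₁)
  obtain ⟨x, hx, hx0, hxx₁⟩ : ∃ x ∈ XH n, cX x ≠ 0 ∧ cX x ≠ cX x₁ := by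
    have hne : ∀ i : Fin n, cX (xH i) ≠ 0 := by
      intro i h
      rw [cX_x] at h
      have := congrFun h i
      simp at this
    let i : Fin n := ⟨0, by omega⟩
    let j : Fin n := ⟨1, by omega⟩
    by_cases hi : cX (xH i) = cX x₁
    · refine ⟨xH j, xH_mem j, hne j, ?_⟩
      rw [← hi, cX_x, cX_x]
      intro h
      have := congrFun h i
      simp [i, j] at this
    · exact ⟨xH i, xH_mem i, hne i, hi⟩
  obtain ⟨y, hy, x', hx', y', hy', e₂⟩ := key x hx
  have hm := vX_eq.1 (e₁.symm.trans e₂)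
  have main : ∀ (π : PV n →+ ZMod 2 × ZMod 2) (l : PV n →+ ZMod 2) (P : ZMod 2 × ZMod 2),
      (if P = 0 then l (cY b) else 0) + (if P + π (cX x₁) = 0 then l (cY a) else 0) =
      (if P + π (cX x) = 0 then l (cY y) else 0) +
        (if P + π (cX x + cX x') = 0 then l (cY y') else 0) := by
    intro π l P
    obtain ⟨F, hF⟩ := exists_F π l P
    have f1 := hF 1 (one_mem _) a ha x₁ hx₁ b hb 1 (one_mem _)
    have f2 := hF _ hm y' hy' x' hx' y hy x hx
    rw [inv_mul_cancel_right, ← one_mul (a * x₁ * b * 1), f1] at f2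
    simpa only [cX_one, map_zero, add_zero, map_add, add_assoc] using f2
  by_cases ht : cX x + cX x' = 0
  · obtain ⟨l, hl⟩ := sep_one ha0
    obtain ⟨π, hp, hq⟩ := sep_three (q := cX x₁ + cX x) (r := cX x₁) hx₁0
      (fun h => hxx₁ (PV_add_eq.1 h).symm) hx₁0
    have := main π l (π (cX x₁))
    rw [ht, ← map_add, ← map_add, PV_add_self, map_zero] at this
    rw [if_neg hq.1] at this
    simp [hp, hl] at this
  · obtain ⟨l, hl⟩ := sep_one hb0
    obtain ⟨π, hp, hq, hr⟩ := sep_three hx₁0 hx0 ht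
    have := main π l 0
    simp only [zero_add, if_neg hp, if_neg hq, if_neg hr] at this
    simp [hl] at this

theorem statement1 (n : ℕ) (hn : 2 ≤ n) :
    (∀ v : SigmaV n, Nat.card ((SigmaGraph n).neighborSet v) = 2 ^ n) ∧
    (∀ u v a b : SigmaV n, (SigmaGraph n).Adj u v → (SigmaGraph n).Adj a b →
      ∃ φ : SigmaGraph n ≃g SigmaGraph n, (φ u = a ∧ φ v = b) ∨ (φ u = b ∧ φ v = a)) ∧
    ¬ (∀ u v : SigmaV n, ∃ φ : SigmaGraph n ≃g SigmaGraph n, φ u = v) := by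
  refine ⟨valency hn, edge_trans hn, fun h => ?_⟩
  obtain ⟨φ, hφ⟩ := h (vY 1) (vX 1)
  exact not_dist_X hn (hφ ▸ farPar_iso φ (dist_Y hn))
end

section
/- Let F be the free group on generators a_1,…,a_r with r ≥ 1, and let K be the subgroup of F generated by F_4 together with all elements a_i², [a_i,a_j]², [[a_i,a_j],a_k]², and [[a_i,a_j],a_i] for i,j,k ∈ {1,…,r}. Then K is a normal subgroup of F, and K is also generated by F_4 together with the set B_K = { a_i², [a_i,a_j]², [[a_i,a_j],a_k]², [[a_i,a_j],a_ℓ] : 1 ≤ j < i ≤ r, j < k ≤ r, k ≠ i, ℓ ∈ {i,j} }. -/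
/-- The free group on `r` generators `a_1, …, a_r`. -/
abbrev FG (r : ℕ) := FreeGroup (Fin r)

/-- The generator `a_i` of the free group. -/
abbrev ag {r : ℕ} (i : Fin r) : FG r := FreeGroup.of i

/-- The subgroup `K` of `F`: generated by `F_4` together with all `a_i²`, `[a_i,a_j]²`,
`[[a_i,a_j],a_k]²` and `[[a_i,a_j],a_i]` (Mathlib's `lowerCentralSeries F 3` is `F_4`). -/
def Ksub (r : ℕ) : Subgroup (FG r) :=
  Subgroup.closure
    ((Subgroup.lowerCentralSeries (⊤ : Subgroup (FG r)) 3 : Set (FG r)) ∪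
      ({w | ∃ i : Fin r, w = ag i ^ 2} ∪
       {w | ∃ i j : Fin r, w = gcomm (ag i) (ag j) ^ 2} ∪
       {w | ∃ i j k : Fin r, w = gcomm (gcomm (ag i) (ag j)) (ag k) ^ 2} ∪
       {w | ∃ i j : Fin r, w = gcomm (gcomm (ag i) (ag j)) (ag i)}))

/-- The set `B_K = { a_i², [a_i,a_j]², [[a_i,a_j],a_k]², [[a_i,a_j],a_ℓ] :
j < i, j < k, k ≠ i, ℓ ∈ {i,j} }`. -/
def BK (r : ℕ) : Set (FG r) :=
  {w | ∃ i : Fin r, w = ag i ^ 2} ∪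
  {w | ∃ i j : Fin r, j < i ∧ w = gcomm (ag i) (ag j) ^ 2} ∪
  {w | ∃ i j k : Fin r, j < i ∧ j < k ∧ k ≠ i ∧
    w = gcomm (gcomm (ag i) (ag j)) (ag k) ^ 2} ∪
  {w | ∃ i j : Fin r, j < i ∧
    (w = gcomm (gcomm (ag i) (ag j)) (ag i) ∨ w = gcomm (gcomm (ag i) (ag j)) (ag j))}

/-- Every `gcomm (gcomm x y) z` is central. -/
def Cl3 (Q : Type*) [Group Q] : Prop :=
  ∀ x y z w : Q, gcomm (gcomm x y) z * w = w * gcomm (gcomm x y) z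

section Cl3lemmas
variable {Q : Type*} [Group Q]

lemma gcomm_swap (x y : Q) : gcomm y x = (gcomm x y)⁻¹ := by
  unfold gcomm; group

lemma gcomm_inv_left (c z : Q) (h : ∀ w, gcomm c z * w = w * gcomm c z) :
    gcomm c⁻¹ z = (gcomm c z)⁻¹ := by
  have h1 : gcomm c⁻¹ z = c * (gcomm c z)⁻¹ * c⁻¹ := by unfold gcomm; group
  have h2 : (gcomm c z)⁻¹ * c⁻¹ = c⁻¹ * (gcomm c z)⁻¹ := by
    rw [← mul_inv_rev, ← mul_inv_rev, h c]
  rw [h1, mul_assoc, h2, mul_inv_cancel_left]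

lemma gcomm_mul_central (c t z : Q) (h : ∀ w, t * w = w * t) :
    gcomm (c * t) z = gcomm c z := by
  have h1 : gcomm (c * t) z = t⁻¹ * (c⁻¹ * z⁻¹ * c) * (t * z) := by unfold gcomm; group
  rw [h1, h z, mul_assoc, ← mul_assoc (c⁻¹ * z⁻¹ * c) z t, ← h (c⁻¹ * z⁻¹ * c * z)]
  unfold gcomm; group

lemma gcomm_sq_left (c z : Q) (h : ∀ w, gcomm c z * w = w * gcomm c z) :
    gcomm (c ^ 2) z = gcomm c z ^ 2 := by
  have h1 : gcomm (c ^ 2) z = c⁻¹ * (gcomm c z * c) * gcomm c z := by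
    unfold gcomm; simp only [pow_two]; group
  rw [h1, h c, inv_mul_cancel_left, pow_two]

lemma gcomm_sq_gen (hQ : Cl3 Q) (x z : Q) :
    gcomm (x ^ 2) z = gcomm x z ^ 2 * gcomm (gcomm x z) x := by
  have h1 : gcomm (x ^ 2) z = gcomm x z * (gcomm (gcomm x z) x * gcomm x z) := by
    unfold gcomm; simp only [pow_two]; group
  rw [h1, hQ, pow_two, mul_assoc]

lemma gcomm_skew (hQ : Cl3 Q) (x y z : Q) :
    gcomm (gcomm y x) z = (gcomm (gcomm x y) z)⁻¹ := by
  rw [gcomm_swap x y, gcomm_inv_left _ _ (hQ x y z)]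

lemma gcomm_inv_mid (hQ : Cl3 Q) (x y z : Q) :
    gcomm (gcomm x y⁻¹) z = (gcomm (gcomm x y) z)⁻¹ := by
  have h1 : gcomm x y⁻¹ = gcomm y x * gcomm (gcomm y x) y⁻¹ := by unfold gcomm; group
  rw [h1, gcomm_mul_central _ _ _ (hQ y x y⁻¹), gcomm_skew hQ]

lemma gcomm_jacobi (hQ : Cl3 Q) (x y z : Q) :
    gcomm (gcomm z x) y * gcomm (gcomm y z) x * gcomm (gcomm x y) z = 1 := by
  have hw : (y⁻¹ * (gcomm (gcomm x y⁻¹) z * y)) * (z⁻¹ * (gcomm (gcomm y z⁻¹) x * z)) *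
      (x⁻¹ * (gcomm (gcomm z x⁻¹) y * x)) = 1 := by
    unfold gcomm; group
  rw [hQ x y⁻¹ z y, hQ y z⁻¹ x z, hQ z x⁻¹ y x] at hw
  simp only [inv_mul_cancel_left, gcomm_inv_mid hQ] at hw
  have := congrArg (·⁻¹) hw
  simpa [mul_assoc] using this

end Cl3lemmas

/-- `F_4`. -/
abbrev F4 (r : ℕ) : Subgroup (FG r) := Subgroup.lowerCentralSeries (⊤ : Subgroup (FG r)) 3

open scoped commutatorElement in
lemma gcomm_mem_lcs {G : Type*} [Group G] (n : ℕ) (x y : G)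
    (hx : x ∈ Subgroup.lowerCentralSeries (⊤ : Subgroup G) n) :
    gcomm x y ∈ Subgroup.lowerCentralSeries (⊤ : Subgroup G) (n + 1) := by
  have : gcomm x y = ⁅x⁻¹, y⁻¹⁆ := by simp [gcomm, commutatorElement_def]
  rw [this]
  exact Subgroup.commutator_mem_commutator (inv_mem hx) (Subgroup.mem_top _)

/-- The projection modulo `F_4`. -/
abbrev pr (r : ℕ) : FG r →* FG r ⧸ F4 r := QuotientGroup.mk' (F4 r)

lemma pr_gcomm {r : ℕ} (x y : FG r) : pr r (gcomm x y) = gcomm (pr r x) (pr r y) := by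
  simp only [gcomm, map_mul, map_inv]

lemma cl3 (r : ℕ) : Cl3 (FG r ⧸ F4 r) := by
  intro x y z w
  obtain ⟨x, rfl⟩ := QuotientGroup.mk'_surjective (F4 r) x
  obtain ⟨y, rfl⟩ := QuotientGroup.mk'_surjective (F4 r) y
  obtain ⟨z, rfl⟩ := QuotientGroup.mk'_surjective (F4 r) z
  obtain ⟨w, rfl⟩ := QuotientGroup.mk'_surjective (F4 r) w
  rw [← pr_gcomm, ← pr_gcomm, ← map_mul, ← map_mul, eq_comm]
  refine QuotientGroup.eq.2 ?_
  have h : gcomm (gcomm (gcomm x y) z) w ∈ F4 r :=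
    gcomm_mem_lcs 2 _ _ (gcomm_mem_lcs 1 _ _ (gcomm_mem_lcs 0 _ _ (Subgroup.mem_top _)))
  convert h using 1
  simp only [gcomm]; group

lemma mem_of_pr {r : ℕ} {H : Subgroup (FG r)} (hH : F4 r ≤ H) {x y : FG r} (hx : x ∈ H)
    (h : pr r y = pr r x) : y ∈ H := by
  have h1 : x⁻¹ * y ∈ F4 r := QuotientGroup.eq.1 h.symm
  simpa using H.mul_mem hx (hH h1)

/-- Conditions making a subgroup contain all generators of `K`. -/
lemma skew_mem {r : ℕ} {H : Subgroup (FG r)} (hH : F4 r ≤ H) {x y z : FG r}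
    (h : gcomm (gcomm x y) z ∈ H) : gcomm (gcomm y x) z ∈ H := by
  refine mem_of_pr hH (H.inv_mem h) ?_
  rw [map_inv]
  simp only [pr_gcomm]
  exact gcomm_skew (cl3 r) _ _ _

lemma skew_sq_mem {r : ℕ} {H : Subgroup (FG r)} (hH : F4 r ≤ H) {x y z : FG r}
    (h : gcomm (gcomm x y) z ^ 2 ∈ H) : gcomm (gcomm y x) z ^ 2 ∈ H := by
  refine mem_of_pr hH (H.inv_mem h) ?_
  rw [map_inv, map_pow, map_pow]
  simp only [pr_gcomm]
  rw [gcomm_skew (cl3 r), inv_pow]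

lemma jacobi_sq_mem {r : ℕ} {H : Subgroup (FG r)} (hH : F4 r ≤ H) {x y z : FG r}
    (h1 : gcomm (gcomm z x) y ^ 2 ∈ H) (h2 : gcomm (gcomm y z) x ^ 2 ∈ H) :
    gcomm (gcomm x y) z ^ 2 ∈ H := by
  refine mem_of_pr hH (H.inv_mem (H.mul_mem h1 h2)) ?_
  rw [map_inv, map_mul, map_pow, map_pow, map_pow]
  simp only [pr_gcomm]
  have h := gcomm_jacobi (cl3 r) (pr r x) (pr r y) (pr r z)
  rw [← (show Commute _ _ from cl3 r (pr r z) (pr r x) (pr r y) _).mul_pow, ← inv_pow,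
    eq_inv_of_mul_eq_one_right h]

lemma F4_le_K (r : ℕ) : F4 r ≤ Ksub r := fun _ hx =>
  Subgroup.subset_closure (Or.inl hx)

lemma K1 {r : ℕ} (i : Fin r) : ag i ^ 2 ∈ Ksub r :=
  Subgroup.subset_closure (Or.inr (Or.inl (Or.inl (Or.inl ⟨i, rfl⟩))))
lemma K2 {r : ℕ} (i j : Fin r) : gcomm (ag i) (ag j) ^ 2 ∈ Ksub r :=
  Subgroup.subset_closure (Or.inr (Or.inl (Or.inl (Or.inr ⟨i, j, rfl⟩))))
lemma K3 {r : ℕ} (i j k : Fin r) : gcomm (gcomm (ag i) (ag j)) (ag k) ^ 2 ∈ Ksub r :=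
  Subgroup.subset_closure (Or.inr (Or.inl (Or.inr ⟨i, j, k, rfl⟩)))
lemma K4 {r : ℕ} (i j : Fin r) : gcomm (gcomm (ag i) (ag j)) (ag i) ∈ Ksub r :=
  Subgroup.subset_closure (Or.inr (Or.inr ⟨i, j, rfl⟩))

/-- Triple commutators are central modulo `F_4`. -/
lemma triple_central {r : ℕ} (x y z w : FG r) : gcomm (gcomm (gcomm x y) z) w ∈ F4 r :=
  gcomm_mem_lcs 2 _ _ (gcomm_mem_lcs 1 _ _ (gcomm_mem_lcs 0 _ _ (Subgroup.mem_top _)))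

lemma conj_eq {G : Type*} [Group G] (s a : G) : a⁻¹ * s * a = s * gcomm s a := by
  simp only [gcomm]; group

lemma K_gcomm {r : ℕ} (k : Fin r) (s : FG r) (hs : s ∈ Ksub r) :
    (ag k)⁻¹ * s * ag k ∈ Ksub r := by
  have hF := F4_le_K r
  have key : Ksub r ≤ (Ksub r).comap (MulAut.conj (ag k)⁻¹).toMonoidHom := by
    conv_lhs => unfold Ksub
    rw [Subgroup.closure_le]
    have aux : ∀ s, s ∈ Ksub r → gcomm s (ag k) ∈ Ksub r →
        s ∈ ((Ksub r).comap (MulAut.conj (ag k)⁻¹).toMonoidHom : Set (FG r)) := by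
      intro s h1 h2
      have := (Ksub r).mul_mem h1 h2
      rw [← conj_eq] at this
      simpa using this
    rintro s (h | ((⟨i, rfl⟩ | ⟨i, j, rfl⟩) | ⟨i, j, l, rfl⟩) | ⟨i, j, rfl⟩)
    · refine aux _ (hF h) (hF ?_)
      exact Subgroup.lowerCentralSeries_antitone _ (Nat.le_succ 3) (gcomm_mem_lcs 3 _ _ h)
    · refine aux _ (K1 i) (mem_of_pr hF ((Ksub r).mul_mem (K2 i k) (K4 i k)) ?_)
      simp only [pr_gcomm, map_mul, map_pow]
      exact gcomm_sq_gen (cl3 r) _ _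
    · refine aux _ (K2 i j) (mem_of_pr hF (K3 i j k) ?_)
      simp only [pr_gcomm, map_pow]
      exact gcomm_sq_left _ _ (cl3 r _ _ _)
    · refine aux _ (K3 i j l) (hF ?_)
      exact gcomm_mem_lcs 2 _ _ (pow_mem
        (gcomm_mem_lcs 1 _ _ (gcomm_mem_lcs 0 _ _ (Subgroup.mem_top _))) 2)
    · exact aux _ (K4 i j) (hF (triple_central _ _ _ _))
  simpa using key hs

lemma K_normal (r : ℕ) : (Ksub r).Normal := by
  have main : ∀ g : FG r, ∀ s ∈ Ksub r, g⁻¹ * s * g ∈ Ksub r := by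
    intro g
    induction g using FreeGroup.induction_on with
    | C1 => intro s hs; simpa using hs
    | of k => exact K_gcomm k
    | inv_of k _ =>
      intro s hs
      have h1 := (Ksub r).mul_mem ((Ksub r).mul_mem (K1 k) (K_gcomm k s hs))
        ((Ksub r).inv_mem (K1 k))
      convert h1 using 1
      simp only [pow_two]; group
    | mul x y hx hy =>
      intro s hs
      have := hy _ (hx s hs)
      convert this using 1
      group
  refine ⟨fun s hs g => ?_⟩
  simpa using main g⁻¹ s hs

/-- The second generated subgroup. -/
abbrev Lsub (r : ℕ) : Subgroup (FG r) := Subgroup.closure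
  ((Subgroup.lowerCentralSeries (⊤ : Subgroup (FG r)) 3 : Set (FG r)) ∪ BK r)

lemma F4_le_L (r : ℕ) : F4 r ≤ Lsub r := fun _ hx =>
  Subgroup.subset_closure (Or.inl hx)

lemma gcomm_self' {G : Type*} [Group G] (x : G) : gcomm x x = 1 := by simp [gcomm]
lemma gcomm_one' {G : Type*} [Group G] (x : G) : gcomm 1 x = 1 := by simp [gcomm]

lemma L2 {r : ℕ} (i j : Fin r) : gcomm (ag i) (ag j) ^ 2 ∈ Lsub r := by
  have key : ∀ i j : Fin r, j < i → gcomm (ag i) (ag j) ^ 2 ∈ Lsub r := fun i j h =>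
    Subgroup.subset_closure (Or.inr (Or.inl (Or.inl (Or.inr ⟨i, j, h, rfl⟩))))
  rcases lt_trichotomy i j with h | rfl | h
  · rw [gcomm_swap (ag j) (ag i), inv_pow]
    exact (Lsub r).inv_mem (key j i h)
  · rw [gcomm_self', one_pow]; exact one_mem _
  · exact key i j h

lemma L4 {r : ℕ} (i j : Fin r) : gcomm (gcomm (ag i) (ag j)) (ag i) ∈ Lsub r := by
  rcases lt_trichotomy i j with h | rfl | h
  · exact skew_mem (F4_le_L r)
      (Subgroup.subset_closure (Or.inr (Or.inr ⟨j, i, h, Or.inr rfl⟩)))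
  · rw [gcomm_self', gcomm_one']; exact one_mem _
  · exact Subgroup.subset_closure (Or.inr (Or.inr ⟨i, j, h, Or.inl rfl⟩))

lemma L3 {r : ℕ} (i j k : Fin r) : gcomm (gcomm (ag i) (ag j)) (ag k) ^ 2 ∈ Lsub r := by
  have hF := F4_le_L r
  by_cases hij : i = j
  · subst hij
    rw [gcomm_self', gcomm_one', one_pow]; exact one_mem _
  by_cases hki : k = i
  · subst hki; exact pow_mem (L4 _ _) 2
  by_cases hkj : k = j
  · subst hkj; exact pow_mem (skew_mem hF (L4 _ _)) 2
  have key : ∀ i j k : Fin r, j < i → j < k → k ≠ i →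
      gcomm (gcomm (ag i) (ag j)) (ag k) ^ 2 ∈ Lsub r := fun i j k h1 h2 h3 =>
    Subgroup.subset_closure (Or.inr (Or.inl (Or.inr ⟨i, j, k, h1, h2, h3, rfl⟩)))
  rcases lt_or_gt_of_ne hij with h | h
  · rcases lt_or_gt_of_ne hki with h' | h'
    · exact jacobi_sq_mem hF (skew_sq_mem hF (key i k j h' (h'.trans h) (Ne.symm hij)))
        (key j k i (h'.trans h) h' hij)
    · exact skew_sq_mem hF (key j i k h h' hkj)
  · rcases lt_or_gt_of_ne hkj with h' | h'
    · exact jacobi_sq_mem hF (skew_sq_mem hF (key i k j (h'.trans h) h' (Ne.symm hij)))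
        (key j k i h' (h'.trans h) hij)
    · exact key i j k h h' hki

lemma K_eq_L (r : ℕ) : Ksub r = Lsub r := by
  apply le_antisymm
  · unfold Ksub
    rw [Subgroup.closure_le]
    rintro s (h | ((⟨i, rfl⟩ | ⟨i, j, rfl⟩) | ⟨i, j, l, rfl⟩) | ⟨i, j, rfl⟩)
    · exact F4_le_L r h
    · exact Subgroup.subset_closure (Or.inr (Or.inl (Or.inl (Or.inl ⟨i, rfl⟩))))
    · exact L2 i j
    · exact L3 i j l
    · exact L4 i j
  · rw [Subgroup.closure_le]
    rintro s (h | ((⟨i, rfl⟩ | ⟨i, j, _, rfl⟩) | ⟨i, j, l, _, _, _, rfl⟩) | ⟨i, j, _, rfl | rfl⟩)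
    · exact F4_le_K r h
    · exact K1 i
    · exact K2 i j
    · exact K3 i j l
    · exact K4 i j
    · exact skew_mem (F4_le_K r) (K4 j i)

/-- `K` is a normal subgroup of the free group `F`, and `K` is also generated by
`F_4 ∪ B_K`. -/
theorem statement7 (r : ℕ) (hr : 1 ≤ r) :
    (Ksub r).Normal ∧
    Ksub r = Subgroup.closure ((Subgroup.lowerCentralSeries (⊤ : Subgroup (FG r)) 3 : Set (FG r)) ∪ BK r) := by
  exact ⟨K_normal r, K_eq_L r⟩
end
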